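/- Let d, d' ≥ 1, let Σ be an invertible real d'×d' matrix, let V : ℝ^d → ℝ, α : ℝ^d × ℝ^{d'} → ℝ^d, β : ℝ^d × ℝ^{d'} → ℝ^{d'} be C^∞, let h > 0 and set f(x,v) = V(x) + |Σv|². Define L* on smooth functions by −L*u = α·∇_x u + β·∇_v u + (div_x α + div_v β) u − ( hΔ_v u + 4ΣᵀΣv·∇_v u + 4 Tr(ΣᵀΣ) u ), and define Xu = α·h∇_x u + β·h∇_v u + (h/2)(div_x α + div_v β) u and Nu = −h²Δ_v u + 4|ΣᵀΣv|² u − 2h Tr(ΣᵀΣ) u. Assume the relation (★): α·∇_xV + 2β·ΣᵀΣv − (h/2)(div_x α + div_v β) = 0 on ℝ^d × ℝ^{d'}. Then for every C^∞ function u : ℝ^d × ℝ^{d'} → ℝ and every point (x,v): −e^{f(x,v)/h} · h · L*( e^{−f/h} u )(x,v) = (Xu)(x,v) + (Nu)(x,v). That is, the conjugated operator P = −e^{f/h} ∘ hL* ∘ e^{−f/h} equals X + N. -/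

import Mathlib

noncomputable section

/-- Points of the phase space `ℝ^d × ℝ^{d'}`. -/
abbrev KPt (d d' : ℕ) := (Fin d → ℝ) × (Fin d' → ℝ)

/-- Partial derivative of `g` in the `i`-th position variable. -/
noncomputable def pdX (d d' : ℕ) (g : KPt d d' → ℝ) (i : Fin d) (p : KPt d d') : ℝ :=
  fderiv ℝ (fun x => g (x, p.2)) p.1 (Pi.single i 1)

/-- Partial derivative of `g` in the `j`-th velocity variable. -/
noncomputable def pdV (d d' : ℕ) (g : KPt d d' → ℝ) (j : Fin d') (p : KPt d d') : ℝ :=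
  fderiv ℝ (fun v => g (p.1, v)) p.2 (Pi.single j 1)

/-- Divergence in the position variables. -/
noncomputable def divX (d d' : ℕ) (α : KPt d d' → Fin d → ℝ) (p : KPt d d') : ℝ :=
  ∑ i, pdX d d' (fun q => α q i) i p

/-- Divergence in the velocity variables. -/
noncomputable def divV (d d' : ℕ) (β : KPt d d' → Fin d' → ℝ) (p : KPt d d') : ℝ :=
  ∑ j, pdV d d' (fun q => β q j) j p

/-- Laplacian in the velocity variables. -/
noncomputable def lapV (d d' : ℕ) (g : KPt d d' → ℝ) (p : KPt d d') : ℝ :=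
  ∑ j, pdV d d' (fun q => pdV d d' g j q) j p

/-- `f(x,v) = V(x) + |Σv|²`. -/
noncomputable def fKFP (d d' : ℕ) (S : Matrix (Fin d') (Fin d') ℝ)
    (V : (Fin d → ℝ) → ℝ) (p : KPt d d') : ℝ :=
  V p.1 + ∑ j, (S.mulVec p.2 j) ^ 2

/-- The operator `L*` defined by
`−L*u = α·∇_x u + β·∇_v u + (div_x α + div_v β) u − (hΔ_v u + 4ΣᵀΣv·∇_v u + 4 Tr(ΣᵀΣ) u)`. -/
noncomputable def Lstar (d d' : ℕ) (h : ℝ) (S : Matrix (Fin d') (Fin d') ℝ)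
    (α : KPt d d' → Fin d → ℝ) (β : KPt d d' → Fin d' → ℝ)
    (u : KPt d d' → ℝ) (p : KPt d d') : ℝ :=
  -((∑ i, α p i * pdX d d' u i p) + (∑ j, β p j * pdV d d' u j p)
      + (divX d d' α p + divV d d' β p) * u p
      - (h * lapV d d' u p
          + 4 * (∑ j, (S.transpose * S).mulVec p.2 j * pdV d d' u j p)
          + 4 * (S.transpose * S).trace * u p))

/-- The transport operator
`Xu = α·h∇_x u + β·h∇_v u + (h/2)(div_x α + div_v β) u`. -/
noncomputable def Xop (d d' : ℕ) (h : ℝ) (α : KPt d d' → Fin d → ℝ)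
    (β : KPt d d' → Fin d' → ℝ) (u : KPt d d' → ℝ) (p : KPt d d') : ℝ :=
  (∑ i, α p i * (h * pdX d d' u i p)) + (∑ j, β p j * (h * pdV d d' u j p))
    + h / 2 * (divX d d' α p + divV d d' β p) * u p

/-- The operator `Nu = −h²Δ_v u + 4|ΣᵀΣv|² u − 2h Tr(ΣᵀΣ) u`. -/
noncomputable def Nop (d d' : ℕ) (h : ℝ) (S : Matrix (Fin d') (Fin d') ℝ)
    (u : KPt d d' → ℝ) (p : KPt d d') : ℝ :=
  -h ^ 2 * lapV d d' u p + 4 * (∑ j, ((S.transpose * S).mulVec p.2 j) ^ 2) * u p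
    - 2 * h * (S.transpose * S).trace * u p

lemma hasFDerivAt_quad (d' : ℕ) (S : Matrix (Fin d') (Fin d') ℝ) (v : Fin d' → ℝ) :
    ∃ L : (Fin d' → ℝ) →L[ℝ] ℝ,
      HasFDerivAt (fun v : Fin d' → ℝ => ∑ k, (S.mulVec v k) ^ 2) L v ∧
      ∀ j, L (Pi.single j 1) = 2 * (S.transpose * S).mulVec v j := by
  have h1 : ∀ k, HasFDerivAt (fun v : Fin d' → ℝ => S.mulVec v k)
      ((ContinuousLinearMap.proj k).comp (LinearMap.toContinuousLinearMap S.mulVecLin)) v := by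
    intro k
    exact ((ContinuousLinearMap.proj (R := ℝ) (φ := fun _ : Fin d' => ℝ) k).comp
      (LinearMap.toContinuousLinearMap S.mulVecLin)).hasFDerivAt
  refine ⟨_, HasFDerivAt.fun_sum (fun k _ => (h1 k).pow 2), ?_⟩
  intro j
  rw [← Matrix.mulVec_mulVec]
  simp only [Matrix.mulVec, dotProduct, Matrix.transpose_apply, Finset.mul_sum]
  simp [Matrix.mulVec, dotProduct, Finset.mul_sum, Finset.sum_mul]
  refine Finset.sum_congr rfl fun k _ => Finset.sum_congr rfl fun l _ => ?_
  ring

lemma hasFDerivAt_w (d' : ℕ) (A : Matrix (Fin d') (Fin d') ℝ) (v : Fin d' → ℝ) (k : Fin d') :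
    ∃ L : (Fin d' → ℝ) →L[ℝ] ℝ,
      HasFDerivAt (fun v : Fin d' → ℝ => A.mulVec v k) L v ∧ L (Pi.single k 1) = A k k := by
  refine ⟨_, ((ContinuousLinearMap.proj (R := ℝ) (φ := fun _ : Fin d' => ℝ) k).comp
      (LinearMap.toContinuousLinearMap A.mulVecLin)).hasFDerivAt, ?_⟩
  simp

lemma pdV_conj (d d' : ℕ) (h : ℝ) (S : Matrix (Fin d') (Fin d') ℝ)
    (V : (Fin d → ℝ) → ℝ) (g : KPt d d' → ℝ) (p : KPt d d')
    (hg : DifferentiableAt ℝ (fun v => g (p.1, v)) p.2) (j : Fin d') :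
    pdV d d' (fun q => Real.exp (-(fKFP d d' S V q) / h) * g q) j p
      = Real.exp (-(fKFP d d' S V p) / h) *
        (pdV d d' g j p - 2 * (S.transpose * S).mulVec p.2 j / h * g p) := by
  obtain ⟨L, hL, hLj⟩ := hasFDerivAt_quad d' S p.2
  have h2 := ((((hL.const_add (V p.1)).neg).mul_const h⁻¹).exp).mul hg.hasFDerivAt
  have h3 : HasFDerivAt
      (fun v => Real.exp (-(fKFP d d' S V (p.1, v)) / h) * g (p.1, v)) _ p.2 := h2
  unfold pdV
  rw [h3.fderiv]
  simp [hLj, fKFP, div_eq_mul_inv]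
  ring

lemma pdX_conj (d d' : ℕ) (h : ℝ) (S : Matrix (Fin d') (Fin d') ℝ)
    (V : (Fin d → ℝ) → ℝ) (g : KPt d d' → ℝ) (p : KPt d d')
    (hV : DifferentiableAt ℝ V p.1)
    (hg : DifferentiableAt ℝ (fun x => g (x, p.2)) p.1) (i : Fin d) :
    pdX d d' (fun q => Real.exp (-(fKFP d d' S V q) / h) * g q) i p
      = Real.exp (-(fKFP d d' S V p) / h) *
        (pdX d d' g i p - fderiv ℝ V p.1 (Pi.single i 1) / h * g p) := by
  have h2 := ((((hV.hasFDerivAt.add_const (∑ j, (S.mulVec p.2 j) ^ 2)).neg).mul_const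
    h⁻¹).exp).mul hg.hasFDerivAt
  have h3 : HasFDerivAt
      (fun x => Real.exp (-(fKFP d d' S V (x, p.2)) / h) * g (x, p.2)) _ p.1 := h2
  unfold pdX
  rw [h3.fderiv]
  simp [fKFP, div_eq_mul_inv]
  ring

lemma pdV_two (d d' : ℕ) (h : ℝ) (S : Matrix (Fin d') (Fin d') ℝ)
    (V : (Fin d → ℝ) → ℝ) (u : KPt d d' → ℝ) (hu : ContDiff ℝ (⊤ : ℕ∞) u)
    (p : KPt d d') (j : Fin d') :
    pdV d d' (fun q => pdV d d' (fun q => Real.exp (-(fKFP d d' S V q) / h) * u q) j q) j p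
      = Real.exp (-(fKFP d d' S V p) / h) *
        (pdV d d' (fun q => pdV d d' u j q) j p
          - 4 * (S.transpose * S).mulVec p.2 j / h * pdV d d' u j p
          - 2 * (S.transpose * S) j j / h * u p
          + 4 * ((S.transpose * S).mulVec p.2 j) ^ 2 / h ^ 2 * u p) := by
  have hc : ∀ x, ContDiff ℝ (⊤ : ℕ∞) (fun v => u (x, v)) := fun x =>
    hu.comp (contDiff_const.prodMk contDiff_id)
  have hd1 : ∀ x, Differentiable ℝ (fun v => u (x, v)) := fun x =>
    (hc x).differentiable (by simp)
  have e1 : (fun q => pdV d d' (fun q => Real.exp (-(fKFP d d' S V q) / h) * u q) j q)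
      = fun q => Real.exp (-(fKFP d d' S V q) / h) *
        (pdV d d' u j q - 2 * (S.transpose * S).mulVec q.2 j / h * u q) := by
    funext q
    exact pdV_conj d d' h S V u q (hd1 _ _) j
  have hpd : DifferentiableAt ℝ (fun v => pdV d d' u j (p.1, v)) p.2 := by
    have : ContDiff ℝ 1 (fderiv ℝ (fun v => u (p.1, v))) :=
      ContDiff.fderiv_right (n := 2) ((hc p.1).of_le (WithTop.coe_le_coe.2 (le_top : (2 : ℕ∞) ≤ ⊤))) (by norm_num)
    exact ((this.differentiable (by simp)) p.2).clm_apply (differentiableAt_const _)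
  obtain ⟨L, hL, hLj⟩ := hasFDerivAt_w d' (S.transpose * S) p.2 j
  have h2 := hpd.hasFDerivAt.sub (((hL.const_mul 2).mul_const h⁻¹).mul (hd1 p.1 p.2).hasFDerivAt)
  have h3 : HasFDerivAt (fun v => pdV d d' u j (p.1, v)
      - 2 * (S.transpose * S).mulVec v j / h * u (p.1, v)) _ p.2 := h2
  rw [e1, pdV_conj d d' h S V
    (fun q => pdV d d' u j q - 2 * (S.transpose * S).mulVec q.2 j / h * u q) p
    h3.differentiableAt j]
  have e2 : pdV d d' (fun q => pdV d d' u j q - 2 * (S.transpose * S).mulVec q.2 j / h * u q) j p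
      = pdV d d' (fun q => pdV d d' u j q) j p
        - 2 * (S.transpose * S).mulVec p.2 j / h * pdV d d' u j p
        - 2 * (S.transpose * S) j j / h * u p := by
    conv_lhs => unfold pdV
    have h4 := h3.fderiv
    unfold pdV at h4
    rw [h4]
    simp [hLj, pdV, div_eq_mul_inv]
    ring
  rw [e2]
  ring

/-- Under the relation
`(★) : α·∇_xV + 2β·ΣᵀΣv − (h/2)(div_x α + div_v β) = 0`, for every `C^∞` function `u` and every
point `p`, `−e^{f(p)/h} · h · L*(e^{−f/h} u)(p) = (Xu)(p) + (Nu)(p)`, i.e. the conjugated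
operator `P = −e^{f/h} ∘ hL* ∘ e^{−f/h}` equals `X + N`. -/
theorem stmt14 (d d' : ℕ) (hd : 1 ≤ d) (hd' : 1 ≤ d')
    (S : Matrix (Fin d') (Fin d') ℝ) (hS : IsUnit S)
    (V : (Fin d → ℝ) → ℝ) (hV : ContDiff ℝ (⊤ : ℕ∞) V)
    (α : KPt d d' → Fin d → ℝ) (hα : ContDiff ℝ (⊤ : ℕ∞) α)
    (β : KPt d d' → Fin d' → ℝ) (hβ : ContDiff ℝ (⊤ : ℕ∞) β)
    (h : ℝ) (hh : 0 < h)
    (hstar : ∀ p : KPt d d',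
      (∑ i, α p i * fderiv ℝ V p.1 (Pi.single i 1))
        + 2 * (∑ j, β p j * (S.transpose * S).mulVec p.2 j)
        - h / 2 * (divX d d' α p + divV d d' β p) = 0) :
    ∀ u : KPt d d' → ℝ, ContDiff ℝ (⊤ : ℕ∞) u → ∀ p : KPt d d',
      -Real.exp (fKFP d d' S V p / h) * h *
          Lstar d d' h S α β (fun q => Real.exp (-(fKFP d d' S V q) / h) * u q) p
        = Xop d d' h α β u p + Nop d d' h S u p := by
  intro u hu p
  have hst := hstar p
  have hcx : ContDiff ℝ (⊤ : ℕ∞) (fun x => u (x, p.2)) :=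
    hu.comp (contDiff_id.prodMk contDiff_const)
  have hcv : ContDiff ℝ (⊤ : ℕ∞) (fun v => u (p.1, v)) :=
    hu.comp (contDiff_const.prodMk contDiff_id)
  have hX := fun i => pdX_conj d d' h S V u p (hV.differentiable (by simp) _)
    (hcx.differentiable (by simp) _) i
  have hVv := fun j => pdV_conj d d' h S V u p (hcv.differentiable (by simp) _) j
  have h2 := fun j => pdV_two d d' h S V u hu p j
  have hne : h ≠ 0 := hh.ne'
  have hexp : Real.exp (fKFP d d' S V p / h) * Real.exp (-(fKFP d d' S V p) / h) = 1 := by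
    rw [← Real.exp_add, neg_div, add_neg_cancel, Real.exp_zero]
  unfold Lstar Xop Nop lapV
  simp only [hX, hVv, h2]
  generalize Real.exp (-(fKFP d d' S V p) / h) = E at *
  generalize Real.exp (fKFP d d' S V p / h) = F at *
  have s1 : ∑ i, α p i * (E * (pdX d d' u i p - fderiv ℝ V p.1 (Pi.single i 1) / h * u p))
      = E * (∑ i, α p i * pdX d d' u i p
        - (∑ i, α p i * fderiv ℝ V p.1 (Pi.single i 1)) / h * u p) := by
    simp only [Finset.sum_div, Finset.sum_mul, Finset.mul_sum, ← Finset.sum_sub_distrib]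
    exact Finset.sum_congr rfl fun i _ => by ring
  have s2 : ∀ b : Fin d' → ℝ, ∑ j, b j * (E * (pdV d d' u j p
        - 2 * (S.transpose * S).mulVec p.2 j / h * u p))
      = E * (∑ j, b j * pdV d d' u j p
        - 2 * (∑ j, b j * (S.transpose * S).mulVec p.2 j) / h * u p) := by
    intro b
    simp only [Finset.sum_div, Finset.sum_mul, Finset.mul_sum, ← Finset.sum_sub_distrib]
    exact Finset.sum_congr rfl fun i _ => by ring
  have s3 : ∑ j, E * (pdV d d' (fun q => pdV d d' u j q) j p
          - 4 * (S.transpose * S).mulVec p.2 j / h * pdV d d' u j p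
          - 2 * (S.transpose * S) j j / h * u p
          + 4 * ((S.transpose * S).mulVec p.2 j) ^ 2 / h ^ 2 * u p)
      = E * (∑ j, pdV d d' (fun q => pdV d d' u j q) j p
          - 4 * (∑ j, (S.transpose * S).mulVec p.2 j * pdV d d' u j p) / h
          - 2 * (S.transpose * S).trace / h * u p
          + 4 * (∑ j, ((S.transpose * S).mulVec p.2 j) ^ 2) / h ^ 2 * u p) := by
    simp only [Matrix.trace, Matrix.diag, Finset.sum_div, Finset.sum_mul, Finset.mul_sum,
      ← Finset.sum_sub_distrib, ← Finset.sum_add_distrib]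
    exact Finset.sum_congr rfl fun i _ => by ring
  have s4 : ∑ i, α p i * (h * pdX d d' u i p) = h * ∑ i, α p i * pdX d d' u i p := by
    rw [Finset.mul_sum]
    exact Finset.sum_congr rfl fun i _ => by ring
  have s5 : ∑ j, β p j * (h * pdV d d' u j p) = h * ∑ j, β p j * pdV d d' u j p := by
    rw [Finset.mul_sum]
    exact Finset.sum_congr rfl fun i _ => by ring
  have s6 : ∑ j, (S.transpose * S).mulVec p.2 j * (S.transpose * S).mulVec p.2 j
      = ∑ j, ((S.transpose * S).mulVec p.2 j) ^ 2 :=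
    Finset.sum_congr rfl fun i _ => by ring
  rw [s1, s2, s2, s3, s4, s5, s6]
  generalize (∑ i, α p i * pdX d d' u i p) = a1 at *
  generalize (∑ i, α p i * fderiv ℝ V p.1 (Pi.single i 1)) = a2 at *
  generalize (∑ j, β p j * pdV d d' u j p) = a3 at *
  generalize (∑ j, β p j * (S.transpose * S).mulVec p.2 j) = a4 at *
  generalize (∑ j, ((S.transpose * S).mulVec p.2 j) ^ 2) = a5 at *
  generalize (∑ j, (S.transpose * S).mulVec p.2 j * pdV d d' u j p) = a6 at *
  generalize (∑ j, pdV d d' (fun q => pdV d d' u j q) j p) = a7 at *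
  generalize (S.transpose * S).trace = t at *
  generalize divX d d' α p + divV d d' β p = D at *
  have ha2 : a2 = h / 2 * D - 2 * a4 := by linarith
  subst ha2
  have key : ∀ R : ℝ, F * E * R = R := fun R => by rw [hexp, one_mul]
  trans F * E * (h * a1 + h * a3 + h / 2 * D * u p +
    (-h ^ 2 * a7 + 4 * a5 * u p - 2 * h * t * u p))
  · field_simp
    ring
  · rw [key]
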